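/- Let g = sl₂(ℂ) with standard basis e, f, h, let g̃ = ℂ[t,t⁻¹] ⊗ g be its loop algebra, and write x_r = ι(t^r ⊗ x) ∈ U(g̃). Let λ be a nonnegative integer, a_1, …, a_λ nonzero complex numbers, ω_s = a_1^s + ⋯ + a_λ^s for s ∈ ℤ, and let I be the left ideal of U(g̃) generated by the elements e_r (r ∈ ℤ), h_s − ω_s·1 (s ∈ ℤ), and (f_r)^{λ+1} (r ∈ ℤ). Consider the action of h = h₀ on the quotient W = U(g̃)/I by left multiplication. Then every eigenvalue of this action is of the form λ − 2N for some integer N with 0 ≤ N ≤ λ; that is, if w ∈ W is nonzero and h·w = c·w for some c ∈ ℂ, then c = λ − 2N with 0 ≤ N ≤ λ. -/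

import Mathlib

set_option synthInstance.maxHeartbeats 1000000
set_option maxHeartbeats 1000000

open scoped TensorProduct
open LaurentPolynomial LieAlgebra.SpecialLinear

/-- `e` in the standard basis of `sl₂`. -/
noncomputable def Esl2 : sl (Fin 2) ℂ :=
  ⟨!![0,1;0,0], show _ ∈ LinearMap.ker (Matrix.traceLinearMap (Fin 2) ℂ ℂ) by
    simp [LinearMap.mem_ker, Matrix.trace_fin_two]⟩

/-- `f` in the standard basis of `sl₂`. -/
noncomputable def Fsl2 : sl (Fin 2) ℂ :=
  ⟨!![0,0;1,0], show _ ∈ LinearMap.ker (Matrix.traceLinearMap (Fin 2) ℂ ℂ) by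
    simp [LinearMap.mem_ker, Matrix.trace_fin_two]⟩

/-- `h` in the standard basis of `sl₂`. -/
noncomputable def Hsl2 : sl (Fin 2) ℂ :=
  ⟨!![1,0;0,-1], show _ ∈ LinearMap.ker (Matrix.traceLinearMap (Fin 2) ℂ ℂ) by
    simp [LinearMap.mem_ker, Matrix.trace_fin_two]⟩

/-- The loop algebra `g̃ = ℂ[t,t⁻¹] ⊗ sl₂(ℂ)`. -/
abbrev loopSl2 := ℂ[T;T⁻¹] ⊗[ℂ] (sl (Fin 2) ℂ)

/-- The loop algebra is a Lie algebra over `ℂ`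
(by restriction of scalars from `ℂ[t,t⁻¹]`). -/
noncomputable instance : LieAlgebra ℂ loopSl2 where
  lie_smul t x y := by
    rw [← algebraMap_smul ℂ[T;T⁻¹] t y,
      lie_smul (algebraMap ℂ ℂ[T;T⁻¹] t) x y, algebraMap_smul]

/-- The universal enveloping algebra `U(g̃)`. -/
abbrev Ug : Type := UniversalEnvelopingAlgebra ℂ loopSl2

/-- `e_r = ι(tʳ ⊗ e) ∈ U(g̃)`. -/
noncomputable def Eel (r : ℤ) : Ug :=
  UniversalEnvelopingAlgebra.ι ℂ ((T r : ℂ[T;T⁻¹]) ⊗ₜ[ℂ] Esl2)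

/-- `f_r = ι(tʳ ⊗ f) ∈ U(g̃)`. -/
noncomputable def Fel (r : ℤ) : Ug :=
  UniversalEnvelopingAlgebra.ι ℂ ((T r : ℂ[T;T⁻¹]) ⊗ₜ[ℂ] Fsl2)

/-- `h_r = ι(tʳ ⊗ h) ∈ U(g̃)`. -/
noncomputable def Hel (r : ℤ) : Ug :=
  UniversalEnvelopingAlgebra.ι ℂ ((T r : ℂ[T;T⁻¹]) ⊗ₜ[ℂ] Hsl2)

/-- The defining left ideal of the Weyl module `W(ω)` attached to the Drinfeld
polynomial `ω(u) = ∏ⱼ (1 − aⱼu)`: it is generated by the `e_r`, the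
`h_s − ω_s·1` where `ω_s = ∑ⱼ aⱼˢ`, and the `f_r^{λ+1}`. -/
noncomputable def weylIdeal (lam : ℕ) (a : Fin lam → ℂ) : Ideal Ug :=
  Ideal.span ({x : Ug | ∃ r : ℤ, x = Eel r} ∪
    {x : Ug | ∃ s : ℤ, x = Hel s - algebraMap ℂ Ug (∑ j, a j ^ s)} ∪
    {x : Ug | ∃ r : ℤ, x = Fel r ^ (lam + 1)})

/-- If a cyclic vector `w` satisfies the highest weight relations for operators `E r`, `F r`, `H r`
obeying the loop algebra relations, then the vectors `F r₁ ⋯ F rₖ w` span. -/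
lemma span_lowering_eq_top {M : Type*} [AddCommGroup M] [Module ℂ M]
    {E F H : ℤ → Module.End ℂ M} {w : M} {ω : ℤ → ℂ}
    (hHF : ∀ r s x, H r (F s x) = F s (H r x) - (2 : ℂ) • F (r + s) x)
    (hEF : ∀ r s x, E r (F s x) = F s (E r x) + H (r + s) x)
    (hEw : ∀ r, E r w = 0) (hHw : ∀ r, H r w = ω r • w)
    (hcyc : ∀ S : Submodule ℂ M, w ∈ S → (∀ r, ∀ x ∈ S, E r x ∈ S ∧ F r x ∈ S ∧ H r x ∈ S) →
      S = ⊤) :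
    Submodule.span ℂ (Set.range fun l : List ℤ => (l.map F).prod w) = ⊤ := by
  set S := Submodule.span ℂ (Set.range fun l : List ℤ => (l.map F).prod w) with hS
  have hmem : ∀ l : List ℤ, (l.map F).prod w ∈ S := fun l => Submodule.subset_span ⟨l, rfl⟩
  have stable : ∀ A : Module.End ℂ M, (∀ l : List ℤ, A ((l.map F).prod w) ∈ S) →
      ∀ x ∈ S, A x ∈ S := by
    intro A hA
    suffices S ≤ S.comap A from fun x hx => this hx
    rw [hS, Submodule.span_le]
    rintro _ ⟨l, rfl⟩
    exact hA l
  have hF : ∀ r, ∀ x ∈ S, F r x ∈ S := fun r => stable _ fun l => hmem (r :: l)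
  have hH : ∀ r, ∀ x ∈ S, H r x ∈ S := by
    refine fun r => stable _ fun l => ?_
    induction l with
    | nil => simpa [hHw] using S.smul_mem (ω r) (hmem [])
    | cons s l ih =>
      simp only [List.map_cons, List.prod_cons, Module.End.mul_apply, hHF]
      exact S.sub_mem (hF _ _ ih) (S.smul_mem _ (hF _ _ (hmem l)))
  have hE : ∀ r, ∀ x ∈ S, E r x ∈ S := by
    refine fun r => stable _ fun l => ?_
    induction l with
    | nil => simp [hEw]
    | cons s l ih =>
      simp only [List.map_cons, List.prod_cons, Module.End.mul_apply, hEF]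
      exact S.add_mem (hF _ _ ih) (hH _ _ (hmem l))
  exact hcyc S (hmem []) fun r x hx => ⟨hE r x hx, hF r x hx, hH r x hx⟩

/-- If the eigenspaces of an endomorphism for a family of scalars span, then every eigenvalue is a
member of the family. -/
lemma exists_eq_of_iSup_eigenspace_eq_top {K M ι : Type*} [Field K] [AddCommGroup M] [Module K M]
    {A : Module.End K M} {c : ι → K} (h : ⨆ i, A.eigenspace (c i) = ⊤) {v : M} (hv : v ≠ 0)
    {μ : K} (hμ : A v = μ • v) : ∃ i, μ = c i := by
  by_contra! hne
  have hd : Disjoint (A.eigenspace μ) (⨆ ν, ⨆ (_ : ν ≠ μ), A.eigenspace ν) :=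
    A.eigenspaces_iSupIndep μ
  have htop : (⨆ ν, ⨆ (_ : ν ≠ μ), A.eigenspace ν) = ⊤ :=
    top_le_iff.1 (h ▸ iSup_le fun i => le_iSup₂_of_le (c i) (hne i).symm le_rfl)
  rw [htop, disjoint_top] at hd
  exact hv ((Submodule.mem_bot K).1 (hd ▸ Module.End.mem_eigenspace_iff.2 hμ))

section Sl2

variable {M : Type*} [AddCommGroup M] [Module ℂ M] {E F H : Module.End ℂ M}

lemma weight_pow_of_shift {A : Module.End ℂ M} {d : ℂ}
    (hHA : ∀ x, H (A x) = A (H x) + d • A x) {v : M} {c : ℂ} (hv : H v = c • v) (j : ℕ) :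
    H ((A ^ j) v) = (c + j * d) • (A ^ j) v := by
  induction j with
  | zero => simpa using hv
  | succ j ih =>
    rw [pow_succ', Module.End.mul_apply, hHA, ih, map_smul, ← add_smul]
    push_cast
    ring_nf

lemma lowering_raising_pow (hHE : ∀ x, H (E x) = E (H x) + (2 : ℂ) • E x)
    (hEF : ∀ x, E (F x) = F (E x) + H x) {v : M} {m : ℂ} (hF : F v = 0) (hH : H v = (-m) • v)
    (j : ℕ) : F ((E ^ (j + 1)) v) = ((j + 1) * (m - j)) • (E ^ j) v := by
  have hFE : ∀ x, F (E x) = E (F x) - H x := fun x => by rw [hEF]; abel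
  induction j with
  | zero => simp [hFE, hF, hH]
  | succ j ih =>
    rw [pow_succ', Module.End.mul_apply, hFE, ih, map_smul,
      ← Module.End.mul_apply E, ← pow_succ', weight_pow_of_shift hHE hH, ← sub_smul]
    push_cast
    ring_nf

lemma raising_pow_ne_zero (hHE : ∀ x, H (E x) = E (H x) + (2 : ℂ) • E x)
    (hEF : ∀ x, E (F x) = F (E x) + H x) {v : M} (hv : v ≠ 0) {m : ℕ} (hF : F v = 0)
    (hH : H v = (-(m : ℂ)) • v) {j : ℕ} (hj : j ≤ m) : (E ^ j) v ≠ 0 := by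
  induction j with
  | zero => simpa using hv
  | succ j ih =>
    intro h0
    have h := lowering_raising_pow hHE hEF hF hH j
    rw [h0, map_zero, eq_comm, smul_eq_zero, mul_eq_zero, sub_eq_zero] at h
    rcases h with (h | h) | h
    · exact Nat.cast_add_one_ne_zero j h
    · have : m = j := by exact_mod_cast h
      omega
    · exact ih (by omega) h

/-- If all weights are of the form `n - 2k` and `F` is nilpotent, then all weights are
at least `-n`. -/
lemma weight_le_of_nilpotent (hHE : ∀ x, H (E x) = E (H x) + (2 : ℂ) • E x)
    (hHF : ∀ x, H (F x) = F (H x) + (-2 : ℂ) • F x)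
    (hEF : ∀ x, E (F x) = F (E x) + H x) {n : ℕ}
    (hwt : ∀ v : M, v ≠ 0 → ∀ c : ℂ, H v = c • v → ∃ k : ℕ, c = n - 2 * k)
    (hnil : IsNilpotent F) {v : M} (hv : v ≠ 0) {N : ℕ}
    (hc : H v = ((n : ℂ) - 2 * N) • v) : N ≤ n := by
  classical
  by_contra! hN
  obtain ⟨p, hp⟩ := hnil
  have hex : ∃ p, (F ^ p) v = 0 := ⟨p, by simp [hp]⟩
  obtain ⟨q, hq⟩ : ∃ q, Nat.find hex = q + 1 := by
    refine Nat.exists_eq_succ_of_ne_zero fun h => hv ?_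
    simpa [h] using Nat.find_spec hex
  have hlow : F ((F ^ q) v) = 0 := by
    rw [← Module.End.mul_apply, ← pow_succ', ← hq]
    exact Nat.find_spec hex
  have hne : (F ^ q) v ≠ 0 := Nat.find_min hex (by omega)
  set m := 2 * (N + q) - n with hm
  have hmC : (m : ℂ) = 2 * (N + q) - n := by
    rw [hm, Nat.cast_sub (by omega)]
    push_cast
    ring
  have hHq : H ((F ^ q) v) = (-(m : ℂ)) • (F ^ q) v := by
    rw [weight_pow_of_shift hHF hc, hmC]
    ring_nf
  obtain ⟨k, hk⟩ := hwt _ (raising_pow_ne_zero hHE hEF hne hlow hHq le_rfl) _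
    (weight_pow_of_shift hHE hHq m)
  have : (m : ℂ) + 2 * k = n := by linear_combination hk
  have : m + 2 * k = n := by exact_mod_cast this
  omega

end Sl2

/-- The weights of a cyclic highest weight module of the loop algebra on which some power of `F 0`
kills the generator. -/
lemma exists_weight_eq {M : Type*} [AddCommGroup M] [Module ℂ M]
    {E F H : ℤ → Module.End ℂ M} {w : M} {ω : ℤ → ℂ} {n : ℕ}
    (hHE : ∀ x, H 0 (E 0 x) = E 0 (H 0 x) + (2 : ℂ) • E 0 x)
    (hHF : ∀ r s x, H r (F s x) = F s (H r x) - (2 : ℂ) • F (r + s) x)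
    (hEF : ∀ r s x, E r (F s x) = F s (E r x) + H (r + s) x)
    (hFF : ∀ r s, Commute (F r) (F s))
    (hEw : ∀ r, E r w = 0) (hHw : ∀ r, H r w = ω r • w) (hω : ω 0 = n)
    (hFw : (F 0 ^ (n + 1)) w = 0)
    (hcyc : ∀ S : Submodule ℂ M, w ∈ S → (∀ r, ∀ x ∈ S, E r x ∈ S ∧ F r x ∈ S ∧ H r x ∈ S) →
      S = ⊤) {v : M} (hv : v ≠ 0) {c : ℂ} (hc : H 0 v = c • v) :
    ∃ N : ℕ, N ≤ n ∧ c = (n : ℂ) - 2 * N := by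
  have hspan := span_lowering_eq_top hHF hEF hEw hHw hcyc
  have hHF0 : ∀ x, H 0 (F 0 x) = F 0 (H 0 x) + (-2 : ℂ) • F 0 x := fun x => by
    rw [hHF, zero_add, neg_smul, sub_eq_add_neg]
  have hmon : ∀ l : List ℤ, H 0 ((l.map F).prod w) =
      ((n : ℂ) - 2 * l.length) • (l.map F).prod w := by
    intro l
    induction l with
    | nil => simp [hHw, hω]
    | cons s l ih =>
      rw [List.map_cons, List.prod_cons, Module.End.mul_apply, hHF, ih, map_smul, zero_add,
        ← sub_smul, List.length_cons]
      push_cast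
      ring_nf
  have htop : ⨆ k : ℕ, (H 0).eigenspace ((n : ℂ) - 2 * k) = ⊤ := by
    rw [← top_le_iff, ← hspan, Submodule.span_le]
    rintro _ ⟨l, rfl⟩
    exact Submodule.mem_iSup_of_mem l.length (Module.End.mem_eigenspace_iff.2 (hmon l))
  have hnil : IsNilpotent (F 0) := by
    refine ⟨n + 1, LinearMap.ext_on_range hspan fun l => ?_⟩
    have hcomm : Commute (F 0 ^ (n + 1)) (l.map F).prod :=
      Commute.list_prod_right _ _ (by
        simp only [List.mem_map]
        rintro _ ⟨s, -, rfl⟩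
        exact (hFF 0 s).pow_left _)
    rw [← Module.End.mul_apply, hcomm.eq, Module.End.mul_apply, hFw, map_zero,
      LinearMap.zero_apply]
  have hwt : ∀ v : M, v ≠ 0 → ∀ c : ℂ, H 0 v = c • v → ∃ k : ℕ, c = n - 2 * k :=
    fun v hv c hc => exists_eq_of_iSup_eigenspace_eq_top htop hv hc
  obtain ⟨N, rfl⟩ := hwt v hv c hc
  exact ⟨N, weight_le_of_nilpotent hHE hHF0 (by simpa using hEF 0 0) hwt hnil hv hc, rfl⟩

lemma lie_Esl2_Fsl2 : ⁅Esl2, Fsl2⁆ = Hsl2 := by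
  ext i j
  fin_cases i <;> fin_cases j <;> simp [Esl2, Fsl2, Hsl2, LieRing.of_associative_ring_bracket]

lemma lie_Hsl2_Esl2 : ⁅Hsl2, Esl2⁆ = (2 : ℂ) • Esl2 := by
  ext i j
  fin_cases i <;> fin_cases j <;>
    simp [Esl2, Hsl2, LieRing.of_associative_ring_bracket]
  norm_num

lemma lie_Hsl2_Fsl2 : ⁅Hsl2, Fsl2⁆ = (-2 : ℂ) • Fsl2 := by
  ext i j
  fin_cases i <;> fin_cases j <;>
    simp [Fsl2, Hsl2, LieRing.of_associative_ring_bracket]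
  norm_num

lemma sl2_eq_combination (x : sl (Fin 2) ℂ) :
    x = x.1 0 1 • Esl2 + x.1 1 0 • Fsl2 + x.1 0 0 • Hsl2 := by
  have hx : x.1 0 0 + x.1 1 1 = 0 := by
    rw [← Matrix.trace_fin_two]
    exact x.2
  ext i j
  fin_cases i <;> fin_cases j <;> simp [Esl2, Fsl2, Hsl2]
  linear_combination hx

section Enveloping

attribute [local instance] LieRing.ofAssociativeRing

lemma ι_mul_ι (r s : ℤ) (x y : sl (Fin 2) ℂ) :
    (UniversalEnvelopingAlgebra.ι ℂ ((T r : ℂ[T;T⁻¹]) ⊗ₜ[ℂ] x) : Ug) *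
        UniversalEnvelopingAlgebra.ι ℂ ((T s : ℂ[T;T⁻¹]) ⊗ₜ[ℂ] y) =
      UniversalEnvelopingAlgebra.ι ℂ ((T s : ℂ[T;T⁻¹]) ⊗ₜ[ℂ] y) *
        UniversalEnvelopingAlgebra.ι ℂ ((T r : ℂ[T;T⁻¹]) ⊗ₜ[ℂ] x) +
      UniversalEnvelopingAlgebra.ι ℂ ((T (r + s) : ℂ[T;T⁻¹]) ⊗ₜ[ℂ] ⁅x, y⁆) := by
  rw [T_add, ← LieAlgebra.ExtendScalars.bracket_tmul, LieHom.map_lie,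
    LieRing.of_associative_ring_bracket]
  abel

lemma Eel_mul_Fel (r s : ℤ) : Eel r * Fel s = Fel s * Eel r + Hel (r + s) := by
  rw [Eel, Fel, Hel, ι_mul_ι, lie_Esl2_Fsl2]

lemma Hel_mul_Eel (r s : ℤ) : Hel r * Eel s = Eel s * Hel r + (2 : ℂ) • Eel (r + s) := by
  rw [Eel, Eel, Hel, ι_mul_ι, lie_Hsl2_Esl2, TensorProduct.tmul_smul, map_smul]

lemma Hel_mul_Fel (r s : ℤ) : Hel r * Fel s = Fel s * Hel r - (2 : ℂ) • Fel (r + s) := by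
  rw [Fel, Fel, Hel, ι_mul_ι, lie_Hsl2_Fsl2, TensorProduct.tmul_smul, map_smul,
    neg_smul, sub_eq_add_neg]

lemma commute_Fel (r s : ℤ) : Commute (Fel r) (Fel s) := by
  rw [Commute, SemiconjBy, Fel, Fel, ι_mul_ι, lie_self, TensorProduct.tmul_zero,
    map_zero, add_zero]

/-- The `e_r`, `f_r` and `h_r` generate `U(g̃)`: a subalgebra containing them is everything. -/
lemma subalgebra_eq_top_of_mem {A : Subalgebra ℂ Ug} (hE : ∀ r, Eel r ∈ A) (hF : ∀ r, Fel r ∈ A)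
    (hH : ∀ r, Hel r ∈ A) : A = ⊤ := by
  have hι : ∀ z : loopSl2, (UniversalEnvelopingAlgebra.ι ℂ z : Ug) ∈ A := by
    intro z
    induction z using TensorProduct.induction_on with
    | zero => simp
    | add x y hx hy => rw [map_add]; exact A.add_mem hx hy
    | tmul p x =>
      induction p using LaurentPolynomial.induction_on' with
      | add p q hp hq =>
        rw [TensorProduct.add_tmul, map_add]; exact A.add_mem hp hq
      | C_mul_T n b =>
        rw [← LaurentPolynomial.smul_eq_C_mul, ← TensorProduct.smul_tmul', map_smul,
          sl2_eq_combination x]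
        simp only [TensorProduct.tmul_add, TensorProduct.tmul_smul, map_add,
          map_smul]
        exact A.smul_mem (A.add_mem (A.add_mem (A.smul_mem (hE n) _) (A.smul_mem (hF n) _))
          (A.smul_mem (hH n) _)) _
  rw [eq_top_iff]
  rintro u -
  let φ : loopSl2 →ₗ⁅ℂ⁆ A :=
    { toFun z := ⟨UniversalEnvelopingAlgebra.ι ℂ z, hι z⟩
      map_add' x y := Subtype.ext (map_add _ x y)
      map_smul' c x := Subtype.ext (map_smul _ c x)
      map_lie' {x y} := Subtype.ext (LieHom.map_lie _ x y) }
  have h : A.val.comp (UniversalEnvelopingAlgebra.lift ℂ φ) = AlgHom.id ℂ Ug := by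
    ext z
    simp [φ]
  have hu := DFunLike.congr_fun h u
  rw [AlgHom.id_apply] at hu
  rw [← hu]
  exact (UniversalEnvelopingAlgebra.lift ℂ φ u).2

end Enveloping

/-- Every eigenvalue of the left-multiplication action of `h = h₀` on the Weyl
module `W(ω) = U(g̃)/I` is of the form `λ − 2N` for some `0 ≤ N ≤ λ`. -/
theorem weyl_module_weights (lam : ℕ) (a : Fin lam → ℂ)
    (ha : ∀ j, a j ≠ 0) (u : Ug) (c : ℂ)
    (hu : (Submodule.Quotient.mk (p := (weylIdeal lam a : Submodule Ug Ug)) u) ≠ 0)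
    (hc : Submodule.Quotient.mk (p := (weylIdeal lam a : Submodule Ug Ug)) (Hel 0 * u) =
      c • Submodule.Quotient.mk (p := (weylIdeal lam a : Submodule Ug Ug)) u) :
    ∃ N : ℕ, N ≤ lam ∧ c = (lam : ℂ) - 2 * N := by
  let ρ : Ug →ₐ[ℂ] Module.End ℂ (Ug ⧸ (weylIdeal lam a : Submodule Ug Ug)) :=
    Algebra.lsmul ℂ ℂ (Ug ⧸ (weylIdeal lam a : Submodule Ug Ug))
  have hmk : ∀ x y : Ug, ρ x (Submodule.Quotient.mk y) = Submodule.Quotient.mk (x * y) :=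
    fun _ _ => rfl
  have hgen : ∀ x ∈ weylIdeal lam a, ρ x (Submodule.Quotient.mk 1) = 0 := fun x hx => by
    rw [hmk, mul_one]
    exact (Submodule.Quotient.mk_eq_zero _).2 hx
  refine exists_weight_eq (E := fun r => ρ (Eel r)) (F := fun r => ρ (Fel r))
    (H := fun r => ρ (Hel r)) (w := Submodule.Quotient.mk 1) (ω := fun s => ∑ j, a j ^ s)
    ?_ ?_ ?_ ?_ ?_ ?_ ?_ ?_ ?_ hu (hmk _ _ ▸ hc)
  · intro x
    simpa using DFunLike.congr_fun (congrArg ρ (Hel_mul_Eel 0 0)) x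
  · intro r s x
    simpa using DFunLike.congr_fun (congrArg ρ (Hel_mul_Fel r s)) x
  · intro r s x
    simpa using DFunLike.congr_fun (congrArg ρ (Eel_mul_Fel r s)) x
  · exact fun r s => (commute_Fel r s).map ρ
  · exact fun r => hgen _ (Ideal.subset_span (Or.inl (Or.inl ⟨r, rfl⟩)))
  · intro s
    have h := hgen _ (Ideal.subset_span (Or.inl (Or.inr ⟨s, rfl⟩)))
    rwa [map_sub, LinearMap.sub_apply, sub_eq_zero, AlgHom.commutes,
      Module.algebraMap_end_apply] at h
  · simp
  · rw [← map_pow]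
    exact hgen _ (Ideal.subset_span (Or.inr ⟨0, rfl⟩))
  · intro S hw hS
    let A : Subalgebra ℂ Ug :=
      { carrier := {x | ∀ y ∈ S, ρ x y ∈ S}
        mul_mem' {x y} hx hy z hz := by
          rw [map_mul]
          exact hx _ (hy z hz)
        add_mem' {x y} hx hy z hz := by
          rw [map_add]
          exact S.add_mem (hx z hz) (hy z hz)
        algebraMap_mem' c z hz := by
          rw [AlgHom.commutes]
          exact S.smul_mem c hz }
    have hA : A = ⊤ := subalgebra_eq_top_of_mem (fun r x hx => (hS r x hx).1)
      (fun r x hx => (hS r x hx).2.1) (fun r x hx => (hS r x hx).2.2)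
    rw [eq_top_iff]
    rintro x -
    obtain ⟨x, rfl⟩ := Submodule.Quotient.mk_surjective _ x
    have hx : x ∈ A := hA ▸ Algebra.mem_top
    simpa only [hmk, mul_one] using hx _ hw
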